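/- (Dominance lemma for alternatives' negative flows.) Let r : Fin (k+1) → X be limiting profiles, all pairwise distinct, and let a and b be alternatives, each distinct from all profiles. Suppose a dominates b: g a j ≥ g b j for every criterion j. Then, with R_a = {r 0, …, r k, a} and R_b = {r 0, …, r k, b}, the negative Choquet-flows satisfy φ⁻_{R_a}(a) ≤ φ⁻_{R_b}(b). -/

import Mathlib

open Finset

/-- The 2-additive Choquet integral (Möbius form). -/
noncomputable def CI2 (n : ℕ) (m : Fin n → ℝ) (M : Fin n → Fin n → ℝ)
    (P : Fin n → ℝ) : ℝ :=
  ∑ j, m j * P j + ∑ j, ∑ s, if j < s then M j s * min (P j) (P s) else 0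

/-- The Choquet-outranking degree of `x` over `y` built from evaluations `g` and
preference functions `F`. -/
noncomputable def outrank {X : Type*} (n : ℕ) (m : Fin n → ℝ) (M : Fin n → Fin n → ℝ)
    (g : X → Fin n → ℝ) (F : Fin n → ℝ → ℝ) (x y : X) : ℝ :=
  CI2 n m M (fun j => F j (g x j - g y j))

/-- The positive Choquet-flow of `x` within the finite set `S`. -/
noncomputable def posFlow {X : Type*} [DecidableEq X] (π : X → X → ℝ)
    (S : Finset X) (x : X) : ℝ :=
  (1 / ((S.card : ℝ) - 1)) * ∑ y ∈ S.erase x, π x y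

/-- The negative Choquet-flow of `x` within the finite set `S`. -/
noncomputable def negFlow {X : Type*} [DecidableEq X] (π : X → X → ℝ)
    (S : Finset X) (x : X) : ℝ :=
  (1 / ((S.card : ℝ) - 1)) * ∑ y ∈ S.erase x, π y x

/-- The net Choquet-flow of `x` within the finite set `S`. -/
noncomputable def netFlow {X : Type*} [DecidableEq X] (π : X → X → ℝ)
    (S : Finset X) (x : X) : ℝ :=
  posFlow π S x - negFlow π S x

/-- Partial increments `c s ∈ [0, t]` of the interaction terms of criterion `j` cannot outweigh
an increment `t` of its linear term. -/
theorem mul_add_sum_nonneg_of_mobius {ι : Type*} [Fintype ι] {j : ι} {μ t : ℝ} {w c : ι → ℝ}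
    (hw : w j = 0) (hmono : ∀ S : Finset ι, j ∉ S → 0 ≤ μ + ∑ s ∈ S, w s)
    (ht : 0 ≤ t) (hc : ∀ s, 0 ≤ c s) (hct : ∀ s, c s ≤ t) :
    0 ≤ μ * t + ∑ s, w s * c s := by
  have hS := hmono {s | w s < 0} (by simp [hw])
  have hle : (∑ s with w s < 0, w s) * t ≤ ∑ s, w s * c s := by
    rw [Finset.sum_filter, Finset.sum_mul]
    refine Finset.sum_le_sum fun s _ => ?_
    split_ifs with h
    · exact mul_le_mul_of_nonpos_left (hct s) h.le
    · simpa using mul_nonneg (not_lt.mp h) (hc s)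
  calc 0 ≤ (μ + ∑ s with w s < 0, w s) * t := mul_nonneg hS ht
    _ ≤ μ * t + ∑ s, w s * c s := by rw [add_mul]; gcongr

theorem min_sub_min_le {p q r : ℝ} (h : p ≤ q) : min q r - min p r ≤ q - p := by
  rcases le_total q r with h₁ | h₁ <;> rcases le_total p r with h₂ | h₂ <;>
    simp only [min_eq_left, min_eq_right, h₁, h₂] <;> linarith

/-- The 2-additive Choquet integral is monotone. -/
theorem CI2_mono {n : ℕ} {m : Fin n → ℝ} {M : Fin n → Fin n → ℝ}
    (hsymm : ∀ j s, M j s = M s j) (hdiag : ∀ j, M j j = 0)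
    (hmono : ∀ j (S : Finset (Fin n)), j ∉ S → 0 ≤ m j + ∑ s ∈ S, M j s) :
    Monotone (CI2 n m M) := by
  intro P Q hPQ
  -- The share of criterion `j` in the increment of `min (P j) (P s)`.
  let c : Fin n → Fin n → ℝ := fun j s =>
    min (Q j) (if j < s then Q s else P s) - min (P j) (if j < s then Q s else P s)
  have hpos : 0 ≤ ∑ j, (m j * (Q j - P j) + ∑ s, M j s * c j s) :=
    Finset.sum_nonneg fun j _ => mul_add_sum_nonneg_of_mobius (hdiag j) (hmono j)
      (sub_nonneg.mpr (hPQ j)) (fun s => sub_nonneg.mpr (min_le_min_right _ (hPQ j)))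
      (fun s => min_sub_min_le (hPQ j))
  have hsplit : ∑ j, ∑ s, M j s * c j s
      = ∑ j, ∑ s, if j < s then M j s * (c j s + c s j) else 0 := by
    have hsum : ∑ j, ∑ s, M j s * c j s
        = ∑ j, ∑ s, (if j < s then M j s * c j s else 0)
          + ∑ j, ∑ s, (if s < j then M j s * c j s else 0) := by
      simp only [← Finset.sum_add_distrib]
      refine Finset.sum_congr rfl fun j _ => Finset.sum_congr rfl fun s _ => ?_
      rcases lt_trichotomy j s with h | rfl | h
      · simp [h, h.not_gt]
      · simp [hdiag]
      · simp [h, h.not_gt]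
    rw [hsum, Finset.sum_comm (f := fun j s => if s < j then M j s * c j s else 0)]
    simp only [← Finset.sum_add_distrib]
    refine Finset.sum_congr rfl fun j _ => Finset.sum_congr rfl fun s _ => ?_
    rw [hsymm s j]
    split_ifs <;> ring
  have hdiff : CI2 n m M Q - CI2 n m M P
      = ∑ j, (m j * (Q j - P j) + ∑ s, M j s * c j s) := by
    rw [Finset.sum_add_distrib, hsplit]
    simp only [CI2]
    rw [add_sub_add_comm]
    simp only [← Finset.sum_sub_distrib]
    congr 1
    · exact Finset.sum_congr rfl fun j _ => by ring
    · refine Finset.sum_congr rfl fun j _ => Finset.sum_congr rfl fun s _ => ?_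
      split_ifs with h
      · simp only [c, h, h.not_gt, if_true, if_false, min_comm (Q s) (P j), min_comm (P s) (P j)]
        ring
      · ring
  linarith

/-- Dominance lemma, alternatives' negative flows: if `a` dominates `b`,
then the negative Choquet-flow of `a` in `R_a` is at most that of `b` in `R_b`. -/
theorem dominance_negFlow_alternatives {X : Type*} [DecidableEq X] (n k : ℕ)
    (m : Fin n → ℝ) (M : Fin n → Fin n → ℝ)
    (hsymm : ∀ j s, M j s = M s j) (hdiag : ∀ j, M j j = 0)
    (hmono1 : ∀ j, 0 ≤ m j)
    (hmono2 : ∀ j (S : Finset (Fin n)), j ∉ S → 0 ≤ m j + ∑ s ∈ S, M j s)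
    (g : X → Fin n → ℝ) (F : Fin n → ℝ → ℝ)
    (hF1 : ∀ j, Monotone (F j))
    (hF2 : ∀ j d, 0 ≤ F j d ∧ F j d ≤ 1)
    (hF3 : ∀ j d, d ≤ 0 → F j d = 0)
    (r : Fin (k + 1) → X)
    (hinj : Function.Injective r)
    (a b : X) (ha : ∀ h, a ≠ r h) (hb : ∀ h, b ≠ r h)
    (hdom : ∀ j, g b j ≤ g a j) :
    negFlow (outrank n m M g F) (insert a (Finset.image r Finset.univ)) a
      ≤ negFlow (outrank n m M g F) (insert b (Finset.image r Finset.univ)) b := by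
  have ha' : a ∉ Finset.image r Finset.univ := by simpa using fun h => (ha h).symm
  have hb' : b ∉ Finset.image r Finset.univ := by simpa using fun h => (hb h).symm
  simp only [negFlow, Finset.erase_insert ha', Finset.erase_insert hb',
    Finset.card_insert_of_notMem ha', Finset.card_insert_of_notMem hb']
  refine mul_le_mul_of_nonneg_left (Finset.sum_le_sum fun y _ => ?_) (by simp)
  exact CI2_mono hsymm hdiag hmono2 fun j => hF1 j (sub_le_sub_left (hdom j) _)
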